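/- (Correctness of the full reduction.) Let A be a time-dependent network on a finite vertex set V, let s ≠ d be vertices of V, and let v₁, …, v_k be any enumeration of V \ {s, d}. Define A⁰ = A, and for i = 1, …, k let A^i be the network on V \ {v₁, …, v_i} obtained from A^{i−1} by eliminating v_i, i.e. A^i u v = min(A^{i−1} u v, A^{i−1} v_i v ∘ A^{i−1} u v_i) for u, v in the remaining vertex set. Then the final network A^k on {s, d} satisfies A^k s d (t) = A_{(s,d)}(t) for every t, where A_{(s,d)} is the end-to-end arrival function of the original network A. -/

import Mathlib

open scoped ENNReal

/-- Arrival function of a walk: starting at `u` and then visiting the vertices of `l` in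
order, departing at time `t`. -/
def walkArr {V : Type*} (A : V → V → ℝ≥0∞ → ℝ≥0∞) : V → List V → ℝ≥0∞ → ℝ≥0∞
  | _, [], t => t
  | u, v :: l, t => walkArr A v l (A u v t)

/-- `l` (together with start vertex `s`) encodes a walk from `s` to `d`: the walk is the
nonempty vertex sequence `s :: l`, whose last vertex must be `d`. -/
def IsWalkTo {V : Type*} (s d : V) (l : List V) : Prop :=
  (s :: l).getLast (List.cons_ne_nil _ _) = d

/-- The end-to-end arrival function: infimum over all walks from `s` to `d`. -/
noncomputable def endToEnd {V : Type*} (A : V → V → ℝ≥0∞ → ℝ≥0∞) (s d : V) (t : ℝ≥0∞) :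
    ℝ≥0∞ :=
  ⨅ l : {l : List V // IsWalkTo s d l}, walkArr A s l.1 t

/-- The FIFO conditions on a time-dependent network: each edge arrival function is
monotone and arrival is not before departure. -/
def FIFO {V : Type*} (A : V → V → ℝ≥0∞ → ℝ≥0∞) : Prop :=
  ∀ u v : V, Monotone (A u v) ∧ ∀ t, t ≤ A u v t

/-- Elimination of the vertex `c` from the network `A`: the new arrival function between
`u` and `v` is the pointwise minimum of the old one and the composite route through `c`.
(After the elimination, `c` is no longer used: values of the network at pairs involving
`c` are irrelevant for the remaining vertices.) -/
def elim {V : Type*} (A : V → V → ℝ≥0∞ → ℝ≥0∞) (c : V) : V → V → ℝ≥0∞ → ℝ≥0∞ :=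
  fun u v t => min (A u v t) (A c v (A u c t))

theorem FIFO.elim {V : Type*} {A : V → V → ℝ≥0∞ → ℝ≥0∞} (hA : FIFO A) (c : V) :
    FIFO (elim A c) := by
  intro u v
  refine ⟨fun x y hxy => ?_, fun x => ?_⟩
  · exact min_le_min ((hA u v).1 hxy) ((hA c v).1 ((hA u c).1 hxy))
  · exact le_min ((hA u v).2 x) (((hA u c).2 x).trans ((hA c v).2 _))

theorem walkArr_append {V : Type*} (A : V → V → ℝ≥0∞ → ℝ≥0∞) {u v : V} {p : List V}
    (hp : IsWalkTo u v p) (q : List V) (x : ℝ≥0∞) :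
    walkArr A u (p ++ q) x = walkArr A v q (walkArr A u p x) := by
  induction p generalizing u x with
  | nil =>
    obtain rfl : u = v := hp
    rfl
  | cons w p ih =>
    have htail : IsWalkTo w v p := by simpa [IsWalkTo] using hp
    exact ih htail _

theorem IsWalkTo.append {V : Type*} {u v w : V} {p q : List V} (hp : IsWalkTo u v p)
    (hq : IsWalkTo v w q) : IsWalkTo u w (p ++ q) := by
  induction p generalizing u with
  | nil =>
    obtain rfl : u = v := hp
    exact hq
  | cons a p ih =>
    have htail : IsWalkTo a v p := by simpa [IsWalkTo] using hp
    simpa [IsWalkTo] using ih htail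

/-- Every edge of the reduced network is realized, at each departure time, by a walk of the
original network. -/
theorem exists_walkArr_eq_foldl_elim {V : Type*} (A : V → V → ℝ≥0∞ → ℝ≥0∞) (l : List V)
    (u v : V) (x : ℝ≥0∞) :
    ∃ p, IsWalkTo u v p ∧ walkArr A u p x = l.foldl elim A u v x := by
  induction l using List.reverseRecOn generalizing u v x with
  | nil => exact ⟨[v], rfl, rfl⟩
  | append_singleton l c ih =>
    rw [List.foldl_append, List.foldl_cons, List.foldl_nil]
    rcases min_choice (l.foldl elim A u v x)
      (l.foldl elim A c v (l.foldl elim A u c x)) with h | h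
    · obtain ⟨p, hp, hpx⟩ := ih u v x
      exact ⟨p, hp, hpx.trans h.symm⟩
    · obtain ⟨p, hp, hpx⟩ := ih u c x
      obtain ⟨q, hq, hqx⟩ := ih c v (l.foldl elim A u c x)
      refine ⟨p ++ q, hp.append hq, ?_⟩
      rw [walkArr_append A hp, hpx, hqx]
      exact h.symm

/-- A potential which is feasible along every edge bounds the arrival time of every walk. -/
theorem le_walkArr_of_feasible {V : Type*} {A : V → V → ℝ≥0∞ → ℝ≥0∞} (hA : FIFO A)
    {m : V → ℝ≥0∞} (hm : ∀ u v, m v ≤ A u v (m u)) {u v : V} {p : List V}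
    (hp : IsWalkTo u v p) {x : ℝ≥0∞} (hx : m u ≤ x) : m v ≤ walkArr A u p x := by
  induction p generalizing u x with
  | nil =>
    obtain rfl : u = v := hp
    exact hx
  | cons w p ih =>
    have htail : IsWalkTo w v p := by simpa [IsWalkTo] using hp
    exact ih htail ((hm u w).trans ((hA u w).1 hx))

/-- A potential feasible for the network obtained by eliminating `c` extends to `c`. -/
theorem exists_feasible_insert {V : Type*} [DecidableEq V] {A : V → V → ℝ≥0∞ → ℝ≥0∞}
    (hA : FIFO A) {c : V} {S : Finset V} (hS : S.Nonempty) (hc : c ∉ S) {m : V → ℝ≥0∞}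
    (hm : ∀ u ∈ S, ∀ v ∈ S, m v ≤ elim A c u v (m u)) :
    ∃ m' : V → ℝ≥0∞, (∀ u ∈ S, m' u = m u) ∧
      ∀ u ∈ insert c S, ∀ v ∈ insert c S, m' v ≤ A u v (m' u) := by
  obtain ⟨w, hw, hmin⟩ := S.exists_min_image (fun u => A u c (m u)) hS
  have heq : ∀ u ∈ S, Function.update m c (A w c (m w)) u = m u := fun u hu =>
    Function.update_of_ne (ne_of_mem_of_not_mem hu hc) _ _
  refine ⟨Function.update m c (A w c (m w)), heq, fun u hu v hv => ?_⟩
  rcases Finset.mem_insert.1 hu with rfl | huS <;> rcases Finset.mem_insert.1 hv with rfl | hvS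
  · exact (hA _ _).2 _
  · rw [heq v hvS, Function.update_self]
    exact (hm w hw v hvS).trans (min_le_right _ _)
  · rw [heq u huS, Function.update_self]
    exact hmin u huS
  · rw [heq u huS, heq v hvS]
    exact (hm u huS v hvS).trans (min_le_left _ _)

theorem exists_feasible_foldl_elim {V : Type*} [DecidableEq V] {A : V → V → ℝ≥0∞ → ℝ≥0∞}
    (hA : FIFO A) {s d : V} (hsd : s ≠ d) {l : List V} (hnd : l.Nodup) (hs : s ∉ l)
    (hd : d ∉ l) (t : ℝ≥0∞) :
    ∃ m : V → ℝ≥0∞, m s = t ∧ m d = l.foldl elim A s d t ∧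
      ∀ u ∈ l.toFinset ∪ {s, d}, ∀ v ∈ l.toFinset ∪ {s, d}, m v ≤ A u v (m u) := by
  induction l generalizing A with
  | nil =>
    refine ⟨Function.update (fun _ => t) d (A s d t), by simp [hsd], by simp, ?_⟩
    have h₁ := (hA s s).2 t
    have h₂ := (hA d d).2 (A s d t)
    have h₃ := ((hA s d).2 t).trans ((hA d s).2 _)
    simp [hsd, h₁, h₂, h₃]
  | cons c l ih =>
    simp only [List.mem_cons, not_or] at hs hd
    obtain ⟨hcl, hnd⟩ := List.nodup_cons.1 hnd
    obtain ⟨m, hms, hmd, hm⟩ := ih (hA.elim c) hnd hs.2 hd.2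
    obtain ⟨m', heq, hm'⟩ := exists_feasible_insert hA ⟨s, by simp⟩
      (by simp [hcl, Ne.symm hs.1, Ne.symm hd.1]) hm
    refine ⟨m', (heq s (by simp)).trans hms, (heq d (by simp)).trans hmd, ?_⟩
    rwa [List.toFinset_cons, Finset.insert_union]

/-- Correctness of the full reduction: successively eliminating all vertices other than
the two terminals `s ≠ d`, in any order, yields a network on `{s, d}` whose `s`-`d` edge
arrival function equals the end-to-end arrival function of the original network. -/
theorem full_reduction_correct {V : Type*} [Fintype V] [DecidableEq V]
    (A : V → V → ℝ≥0∞ → ℝ≥0∞) (hA : FIFO A) (s d : V) (hsd : s ≠ d)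
    (l : List V) (hnd : l.Nodup) (hmem : ∀ v : V, v ∈ l ↔ v ≠ s ∧ v ≠ d) (t : ℝ≥0∞) :
    (l.foldl elim A) s d t = endToEnd A s d t := by
  apply le_antisymm
  · have hs : s ∉ l := fun h => ((hmem s).1 h).1 rfl
    have hd : d ∉ l := fun h => ((hmem d).1 h).2 rfl
    obtain ⟨m, hms, hmd, hm⟩ := exists_feasible_foldl_elim hA hsd hnd hs hd t
    have hall : ∀ v, v ∈ l.toFinset ∪ {s, d} := fun v => by
      simp only [Finset.mem_union, List.mem_toFinset, hmem, Finset.mem_insert,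
        Finset.mem_singleton]
      tauto
    rw [← hmd]
    exact le_iInf fun p =>
      le_walkArr_of_feasible hA (fun u v => hm u (hall u) v (hall v)) p.2 hms.le
  · obtain ⟨p, hp, hpt⟩ := exists_walkArr_eq_foldl_elim A l s d t
    rw [← hpt]
    exact iInf_le (fun q : {q : List V // IsWalkTo s d q} => walkArr A s q.1 t) ⟨p, hp⟩
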